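/- Let (X,d,m) be an isotropic PI space and let E ⊆ X be a set of finite perimeter. Fix Borel sets B, B' ⊆ X with E ⊆ B ⊆ B'. If E is indecomposable in B, then E is indecomposable in B'. -/

import Mathlib

open MeasureTheory Metric Filter Set
open scoped ENNReal NNReal Topology

namespace PaperBV

noncomputable section

variable {X : Type*} [MetricSpace X]

/-- `f` is locally Lipschitz on `Ω`. -/
def LocLipOn (Ω : Set X) (f : X → ℝ) : Prop :=
  ∀ x ∈ Ω, ∃ K : ℝ≥0, ∃ t ∈ 𝓝[Ω] x, LipschitzOnWith K f t

/-- The local Lipschitz constant (slope) `lip f` of a function, with value `0` at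
points that are not accumulation points (there the filter `𝓝[≠] x` is trivial). -/
def lipConst (f : X → ℝ) (x : X) : ℝ≥0∞ :=
  Filter.limsup (fun y => ENNReal.ofReal (|f y - f x| / dist y x)) (𝓝[≠] x)

variable [MeasurableSpace X]

/-- Convergence `fn → f` in `L¹_loc(μ⌊Ω)`. -/
def TendstoL1loc (μ : Measure X) (Ω : Set X) (fn : ℕ → X → ℝ) (f : X → ℝ) : Prop :=
  ∀ K : Set X, IsCompact K → K ⊆ Ω →
    Filter.Tendsto (fun n => ∫⁻ x in K, ENNReal.ofReal |fn n x - f x| ∂μ)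
      Filter.atTop (𝓝 0)

/-- The total variation `|Df|(Ω)` of `f` on an open set `Ω`, defined by relaxation of the
integral of the local Lipschitz constant along locally Lipschitz approximations. -/
def tvOpen (μ : Measure X) (f : X → ℝ) (Ω : Set X) : ℝ≥0∞ :=
  sInf { a : ℝ≥0∞ | ∃ fn : ℕ → X → ℝ, (∀ n, LocLipOn Ω (fn n)) ∧ TendstoL1loc μ Ω fn f ∧
    a = Filter.liminf (fun n => ∫⁻ x in Ω, lipConst (fn n) x ∂μ) Filter.atTop }

/-- The total variation measure `|Df|(B)` of `f` on an arbitrary set, obtained from the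
values on open sets by the Carathéodory construction. -/
def tv (μ : Measure X) (f : X → ℝ) (B : Set X) : ℝ≥0∞ :=
  ⨅ (Ω : Set X) (_ : IsOpen Ω) (_ : B ⊆ Ω), tvOpen μ f Ω

/-- `f` is a function of bounded variation: `f ∈ L¹(μ)` and `|Df|(X) < ∞`. -/
def BVFun (μ : Measure X) (f : X → ℝ) : Prop :=
  MeasureTheory.Integrable f μ ∧ tv μ f Set.univ < ⊤

/-- The perimeter `P(E, B) = |D 1_E|(B)`. -/
def perim (μ : Measure X) (E B : Set X) : ℝ≥0∞ :=
  tv μ (E.indicator fun _ => (1 : ℝ)) B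

/-- `E` is a (Borel) set of finite perimeter. -/
def FinPerim (μ : Measure X) (E : Set X) : Prop :=
  MeasurableSet E ∧ perim μ E Set.univ < ⊤

/-- `μ` is a doubling measure with doubling constant `CD`. -/
def Doubling (μ : Measure X) (CD : ℝ≥0) : Prop :=
  1 ≤ CD ∧ ∀ (x : X) (r : ℝ), 0 < r → μ (ball x (2 * r)) ≤ (CD : ℝ≥0∞) * μ (ball x r)

/-- The mean value `f_{x,r}` of `f` on the ball `B_r(x)`. -/
def ballAvg (μ : Measure X) (f : X → ℝ) (x : X) (r : ℝ) : ℝ :=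
  (∫ y in ball x r, f y ∂μ) / (μ (ball x r)).toReal

/-- The weak `(1,1)`-Poincaré inequality with constants `CP`, `lam`,
for locally Lipschitz functions. -/
def WeakPoincare (μ : Measure X) (CP lam : ℝ) : Prop :=
  ∀ f : X → ℝ, LocLipOn Set.univ f → ∀ (x : X) (r : ℝ), 0 < r →
    ∫⁻ y in ball x r, ENNReal.ofReal |f y - ballAvg μ f x r| ∂μ ≤
      ENNReal.ofReal (CP * r) * ∫⁻ y in ball x (lam * r), lipConst f y ∂μ

/-- A PI space: doubling and supporting a weak `(1,1)`-Poincaré inequality. -/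
def IsPI (μ : Measure X) : Prop :=
  ∃ (CD : ℝ≥0) (CP lam : ℝ), Doubling μ CD ∧ 0 < CP ∧ 1 ≤ lam ∧ WeakPoincare μ CP lam

/-- The pre-measure `H_δ` of the codimension-one Hausdorff measure: infimum over countable
covers by balls of radii at most `δ` of `∑ μ(B_{r_i}(x_i)) / (2 r_i)`. -/
def preH (μ : Measure X) (δ : ℝ) (S : Set X) : ℝ≥0∞ :=
  ⨅ (c : ℕ → X × ℝ) (_ : ∀ i, 0 < (c i).2 ∧ (c i).2 ≤ δ)
    (_ : S ⊆ ⋃ i, ball (c i).1 (c i).2),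
    ∑' i, μ (ball (c i).1 (c i).2) / ENNReal.ofReal (2 * (c i).2)

/-- The codimension-one Hausdorff measure `H = lim_{δ ↓ 0} H_δ = sup_{δ > 0} H_δ`
(as an outer-measure-type set function). -/
def codimH (μ : Measure X) (S : Set X) : ℝ≥0∞ :=
  ⨆ (δ : ℝ) (_ : 0 < δ), preH μ δ S

/-- The upper density of `E` at `x`. -/
def upperDens (μ : Measure X) (E : Set X) (x : X) : ℝ≥0∞ :=
  Filter.limsup (fun r : ℝ => μ (E ∩ ball x r) / μ (ball x r)) (𝓝[>] (0 : ℝ))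

/-- The essential boundary `∂^e E`. -/
def essBdry (μ : Measure X) (E : Set X) : Set X :=
  {x | 0 < upperDens μ E x ∧ 0 < upperDens μ Eᶜ x}

/-- The essential interior `E^1`: points of density `1`. -/
def essInt (μ : Measure X) (E : Set X) : Set X :=
  {x | Filter.Tendsto (fun r : ℝ => μ (E ∩ ball x r) / μ (ball x r))
    (𝓝[>] (0 : ℝ)) (𝓝 (1 : ℝ≥0∞))}

/-- Integral `∫_S f dν` with respect to an outer-measure-type set function `ν`,
via the layer-cake formula. -/
def outerLint (ν : Set X → ℝ≥0∞) (S : Set X) (f : X → ℝ≥0∞) : ℝ≥0∞ :=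
  ∫⁻ t in Set.Ioi (0 : ℝ), ν {x ∈ S | ENNReal.ofReal t < f x}

/-- `θ` is a family of densities representing the perimeter measures with respect to the
codimension-one Hausdorff measure: `P(E,B) = ∫_{B ∩ ∂^e E} θ_E dH`, with
`γ ≤ θ_E ≤ C` on `∂^e E` for structural constants `0 < γ`, `C < ∞`. -/
def PerimRepr (μ : Measure X) (θ : Set X → X → ℝ≥0∞) : Prop :=
  ∃ γ C : ℝ≥0∞, 0 < γ ∧ C ≠ ⊤ ∧
    ∀ E : Set X, FinPerim μ E →
      (∀ x ∈ essBdry μ E, γ ≤ θ E x ∧ θ E x ≤ C) ∧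
      ∀ B : Set X, MeasurableSet B →
        perim μ E B = outerLint (codimH μ) (B ∩ essBdry μ E) (θ E)

/-- The space is isotropic: the densities `θ_E` can be chosen so that, whenever `F ⊆ E` are
sets of finite perimeter, `θ_F = θ_E` holds `H`-a.e. on `∂^e F ∩ ∂^e E`. -/
def Isotropic (μ : Measure X) : Prop :=
  ∃ θ : Set X → X → ℝ≥0∞, PerimRepr μ θ ∧
    ∀ E F : Set X, FinPerim μ E → FinPerim μ F → F ⊆ E →
      codimH μ {x ∈ essBdry μ F ∩ essBdry μ E | θ F x ≠ θ E x} = 0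

/-- Property (1.2): `H(∂^e E ∩ ∂^e F ∩ ∂^e (E ∪ F)) = 0` for disjoint sets of finite
perimeter. -/
def Prop12 (μ : Measure X) : Prop :=
  ∀ E F : Set X, FinPerim μ E → FinPerim μ F → Disjoint E F →
    codimH μ (essBdry μ E ∩ essBdry μ F ∩ essBdry μ (E ∪ F)) = 0

/-- `E` is decomposable in `B`: `E ∩ B` admits a partition into two sets of finite perimeter
and positive measure such that the perimeter in `B` is additive. -/
def DecomposableIn (μ : Measure X) (E B : Set X) : Prop :=
  ∃ F G : Set X, FinPerim μ F ∧ FinPerim μ G ∧ Disjoint F G ∧ F ∪ G = E ∩ B ∧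
    0 < μ F ∧ 0 < μ G ∧ perim μ E B = perim μ F B + perim μ G B

/-- `E` is a set of finite perimeter which is indecomposable in `B`. -/
def IndecomposableIn (μ : Measure X) (E B : Set X) : Prop :=
  FinPerim μ E ∧ ¬ DecomposableIn μ E B

/-- `E` is an indecomposable set (of finite perimeter). -/
def Indecomposable (μ : Measure X) (E : Set X) : Prop :=
  IndecomposableIn μ E Set.univ

/-- `E` is a simple set. -/
def SimpleSet (μ : Measure X) (E : Set X) : Prop :=
  FinPerim μ E ∧ μ E < ⊤ ∧
  ∀ F : Set X, FinPerim μ F → codimH μ (essBdry μ F \ essBdry μ E) = 0 →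
    μ F = 0 ∨ μ Fᶜ = 0 ∨ μ (symmDiff F E) = 0 ∨ μ (symmDiff F Eᶜ) = 0

end

section Hausdorff

variable {X : Type*} [MetricSpace X] [MeasurableSpace X]

lemma preH_le_tsum (μ : Measure X) {δ : ℝ} {S : Set X} (c : ℕ → X × ℝ)
    (hc : ∀ i, 0 < (c i).2 ∧ (c i).2 ≤ δ) (hS : S ⊆ ⋃ i, ball (c i).1 (c i).2) :
    preH μ δ S ≤ ∑' i, μ (ball (c i).1 (c i).2) / ENNReal.ofReal (2 * (c i).2) :=
  iInf_le_of_le c (iInf_le_of_le hc (iInf_le _ hS))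

lemma exists_cover_of_preH_lt {μ : Measure X} {δ : ℝ} {S : Set X} {a : ℝ≥0∞}
    (h : preH μ δ S < a) :
    ∃ c : ℕ → X × ℝ, (∀ i, 0 < (c i).2 ∧ (c i).2 ≤ δ) ∧
      S ⊆ (⋃ i, ball (c i).1 (c i).2) ∧
      ∑' i, μ (ball (c i).1 (c i).2) / ENNReal.ofReal (2 * (c i).2) < a := by
  simpa only [preH, iInf_lt_iff, exists_prop] using h

lemma preH_mono (μ : Measure X) {δ : ℝ} {S T : Set X} (h : S ⊆ T) :
    preH μ δ S ≤ preH μ δ T :=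
  le_iInf fun c => le_iInf fun hc => le_iInf fun hT => preH_le_tsum μ c hc (h.trans hT)

lemma preH_anti (μ : Measure X) {δ ε : ℝ} (h : δ ≤ ε) (S : Set X) :
    preH μ ε S ≤ preH μ δ S :=
  le_iInf fun c => le_iInf fun hc => le_iInf fun hS =>
    preH_le_tsum μ c (fun i => ⟨(hc i).1, (hc i).2.trans h⟩) hS

lemma preH_iUnion_le (μ : Measure X) (δ : ℝ) (S : ℕ → Set X) :
    preH μ δ (⋃ i, S i) ≤ ∑' i, preH μ δ (S i) := by
  refine ENNReal.le_of_forall_pos_le_add fun ε hε hfin => ?_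
  obtain ⟨ε', hε', hsum⟩ :=
    ENNReal.exists_pos_sum_of_countable (ENNReal.coe_pos.2 hε).ne' ℕ
  have hlt : ∀ i, preH μ δ (S i) < preH μ δ (S i) + ε' i := fun i =>
    ENNReal.lt_add_right (ENNReal.ne_top_of_tsum_ne_top hfin.ne i)
      (ENNReal.coe_pos.2 (hε' i)).ne'
  choose c hc hS hlt' using fun i => exists_cover_of_preH_lt (hlt i)
  have hcover : (⋃ i, S i) ⊆ ⋃ k : ℕ, ball (c k.unpair.1 k.unpair.2).1
      (c k.unpair.1 k.unpair.2).2 := by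
    refine iUnion_subset fun i x hx => ?_
    obtain ⟨j, hj⟩ := mem_iUnion.1 (hS i hx)
    exact mem_iUnion.2 ⟨Nat.pair i j, by simpa using hj⟩
  calc preH μ δ (⋃ i, S i)
      ≤ ∑' k : ℕ, μ (ball (c k.unpair.1 k.unpair.2).1 (c k.unpair.1 k.unpair.2).2) /
          ENNReal.ofReal (2 * (c k.unpair.1 k.unpair.2).2) :=
        preH_le_tsum μ (fun k => c k.unpair.1 k.unpair.2) (fun k => hc _ _) hcover
    _ = ∑' p : ℕ × ℕ, μ (ball (c p.1 p.2).1 (c p.1 p.2).2) /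
          ENNReal.ofReal (2 * (c p.1 p.2).2) :=
        Nat.pairEquiv.symm.tsum_eq (fun p : ℕ × ℕ => μ (ball (c p.1 p.2).1 (c p.1 p.2).2) /
          ENNReal.ofReal (2 * (c p.1 p.2).2))
    _ = ∑' i, ∑' j, μ (ball (c i j).1 (c i j).2) / ENNReal.ofReal (2 * (c i j).2) :=
        ENNReal.tsum_prod (f := fun i j => μ (ball (c i j).1 (c i j).2) /
          ENNReal.ofReal (2 * (c i j).2))
    _ ≤ ∑' i, (preH μ δ (S i) + ε' i) := ENNReal.tsum_le_tsum fun i => (hlt' i).le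
    _ = ∑' i, preH μ δ (S i) + ∑' i, (ε' i : ℝ≥0∞) := ENNReal.tsum_add
    _ ≤ ∑' i, preH μ δ (S i) + ε := by gcongr

/-- The hypothesis `preH μ δ ∅ = 0` allows padding a finite cover by arbitrarily cheap balls. -/
lemma preH_ball_le {μ : Measure X} {δ : ℝ} (h0 : preH μ δ ∅ = 0) (x : X) {r : ℝ}
    (hr : 0 < r) (hrδ : r ≤ δ) :
    preH μ δ (ball x r) ≤ μ (ball x r) / ENNReal.ofReal (2 * r) := by
  refine ENNReal.le_of_forall_pos_le_add fun ε hε _ => ?_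
  obtain ⟨c, hc, -, hlt⟩ := exists_cover_of_preH_lt
    (h0.trans_lt (ENNReal.coe_pos.2 hε))
  let d : ℕ → X × ℝ := fun n => Nat.casesOn n (x, r) c
  have hd : ∀ i, 0 < (d i).2 ∧ (d i).2 ≤ δ := by
    rintro (_ | i)
    exacts [⟨hr, hrδ⟩, hc i]
  calc preH μ δ (ball x r)
      ≤ ∑' i, μ (ball (d i).1 (d i).2) / ENNReal.ofReal (2 * (d i).2) :=
        preH_le_tsum μ d hd fun y hy => mem_iUnion.2 ⟨0, hy⟩
    _ = μ (ball x r) / ENNReal.ofReal (2 * r) +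
          ∑' i, μ (ball (c i).1 (c i).2) / ENNReal.ofReal (2 * (c i).2) :=
        tsum_eq_zero_add' ENNReal.summable
    _ ≤ _ := by gcongr

lemma preH_le_tsum_indicator {μ : Measure X} {δ : ℝ} (h0 : preH μ δ ∅ = 0) {S : Set X}
    (c : ℕ → X × ℝ) (hc : ∀ i, 0 < (c i).2 ∧ (c i).2 ≤ δ) (I : Set ℕ)
    (hS : S ⊆ ⋃ i ∈ I, ball (c i).1 (c i).2) :
    preH μ δ S ≤ ∑' i, I.indicator
      (fun i => μ (ball (c i).1 (c i).2) / ENNReal.ofReal (2 * (c i).2)) i := by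
  refine ((preH_mono μ hS).trans (preH_iUnion_le μ δ _)).trans
    (ENNReal.tsum_le_tsum fun i => ?_)
  by_cases hi : i ∈ I
  · simpa [hi] using preH_ball_le h0 (c i).1 (hc i).1 (hc i).2
  · simp [hi, h0]

lemma preH_add_le_of_separated {μ : Measure X} {δ : ℝ} (h0 : preH μ δ ∅ = 0) {s t : Set X}
    (hst : ∀ x ∈ s, ∀ y ∈ t, 2 * δ ≤ dist x y) :
    preH μ δ s + preH μ δ t ≤ preH μ δ (s ∪ t) := by
  refine le_iInf fun c => le_iInf fun hc => le_iInf fun hcov => ?_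
  let I : Set ℕ := {i | (ball (c i).1 (c i).2 ∩ s).Nonempty}
  have hs : s ⊆ ⋃ i ∈ I, ball (c i).1 (c i).2 := fun x hx => by
    obtain ⟨i, hi⟩ := mem_iUnion.1 (hcov (Or.inl hx))
    exact mem_iUnion₂.2 ⟨i, ⟨x, hi, hx⟩, hi⟩
  have ht : t ⊆ ⋃ i ∈ Iᶜ, ball (c i).1 (c i).2 := fun y hy => by
    obtain ⟨i, hi⟩ := mem_iUnion.1 (hcov (Or.inr hy))
    refine mem_iUnion₂.2 ⟨i, ?_, hi⟩
    rintro ⟨x, hxi, hx⟩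
    have h1 := hst x hx y hy
    have h2 := dist_triangle_right x y (c i).1
    rw [mem_ball] at hxi hi
    linarith [(hc i).2]
  refine (add_le_add (preH_le_tsum_indicator h0 c hc I hs)
    (preH_le_tsum_indicator h0 c hc Iᶜ ht)).trans_eq ?_
  rw [← ENNReal.tsum_add]
  exact tsum_congr fun i => congr_fun (indicator_self_add_compl I _) i

lemma preH_le_codimH (μ : Measure X) {δ : ℝ} (hδ : 0 < δ) (S : Set X) :
    preH μ δ S ≤ codimH μ S :=
  le_iSup₂ (f := fun (δ : ℝ) (_ : 0 < δ) => preH μ δ S) δ hδ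

/-- The codimension-one Hausdorff measure as an outer measure. -/
noncomputable def codimHOuter (μ : Measure X) (h0 : codimH μ ∅ = 0) : OuterMeasure X where
  measureOf := codimH μ
  empty := h0
  mono h := iSup₂_mono fun _ _ => preH_mono μ h
  iUnion_nat S _ := iSup₂_le fun δ hδ => (preH_iUnion_le μ δ S).trans
    (ENNReal.tsum_le_tsum fun i => preH_le_codimH μ hδ (S i))

lemma isMetric_codimHOuter (μ : Measure X) (h0 : codimH μ ∅ = 0) :
    (codimHOuter μ h0).IsMetric := by
  rintro s t ⟨r, hr0, hr⟩
  refine le_antisymm (measure_union_le s t) ?_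
  obtain ⟨ρ, hρ0, hρ⟩ : ∃ ρ : ℝ, 0 < ρ ∧ ENNReal.ofReal ρ ≤ r := by
    obtain ⟨q, hq0, hq⟩ := ENNReal.lt_iff_exists_nnreal_btwn.1 (pos_iff_ne_zero.2 hr0)
    exact ⟨q, by exact_mod_cast hq0, by simpa using hq.le⟩
  have hdist : ∀ x ∈ s, ∀ y ∈ t, ρ ≤ dist x y := fun x hx y hy => by
    have := hρ.trans (hr x hx y hy)
    rwa [edist_dist, ENNReal.ofReal_le_ofReal_iff dist_nonneg] at this
  refine ENNReal.biSup_add_biSup_le' (p := fun δ : ℝ => 0 < δ) (q := fun δ : ℝ => 0 < δ)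
    ⟨1, one_pos⟩ ⟨1, one_pos⟩ fun δ hδ ε hε => ?_
  have hη : 0 < min (min δ ε) (ρ / 2) := lt_min (lt_min hδ hε) (half_pos hρ0)
  have hη0 : preH μ (min (min δ ε) (ρ / 2)) ∅ = 0 :=
    le_antisymm ((preH_le_codimH μ hη ∅).trans_eq h0) bot_le
  refine (add_le_add (preH_anti μ ((min_le_left _ _).trans (min_le_left _ _)) s)
    (preH_anti μ ((min_le_left _ _).trans (min_le_right _ _)) t)).trans
    ((preH_add_le_of_separated hη0 fun x hx y hy => ?_).trans (preH_le_codimH μ hη _))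
  linarith [hdist x hx y hy, min_le_right (min δ ε) (ρ / 2)]

end Hausdorff

section Perimeter

variable {X : Type*} [MetricSpace X] [MeasurableSpace X]

lemma outerLint_inter_add_diff [BorelSpace X] (m : OuterMeasure X) (hm : m.IsMetric)
    (S : Set X) (f : X → ℝ≥0∞) {B : Set X} (hB : MeasurableSet B) :
    outerLint m S f = outerLint m (S ∩ B) f + outerLint m (S \ B) f := by
  have hanti : Antitone fun t : ℝ => m {x ∈ S ∩ B | ENNReal.ofReal t < f x} :=
    fun a b hab => measure_mono fun x hx =>
      ⟨hx.1, (ENNReal.ofReal_le_ofReal hab).trans_lt hx.2⟩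
  unfold outerLint
  rw [← lintegral_add_left hanti.measurable]
  refine lintegral_congr fun t => ?_
  have hcar := hm.le_caratheodory B hB {x ∈ S | ENNReal.ofReal t < f x}
  rw [hcar]
  congr 2 <;> ext x <;> simp only [mem_inter_iff, Set.mem_sdiff, mem_ofPred_eq] <;> tauto

lemma upperDens_mono (μ : Measure X) {E F : Set X} (h : E ⊆ F) (x : X) :
    upperDens μ E x ≤ upperDens μ F x :=
  limsup_le_limsup (Eventually.of_forall fun r =>
    ENNReal.div_le_div_right (measure_mono (inter_subset_inter_left _ h)) _)

lemma upperDens_union_eq_zero {μ : Measure X} {F G : Set X} {x : X}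
    (hF : upperDens μ F x = 0) (hG : upperDens μ G x = 0) : upperDens μ (F ∪ G) x = 0 := by
  have tends : ∀ {A : Set X}, upperDens μ A x = 0 →
      Tendsto (fun r : ℝ => μ (A ∩ ball x r) / μ (ball x r)) (𝓝[>] 0) (𝓝 0) := fun hA =>
    tendsto_of_le_liminf_of_limsup_le bot_le hA.le
  refine le_antisymm ?_ bot_le
  have hlim := ((tends hF).add (tends hG)).limsup_eq
  rw [add_zero] at hlim
  refine le_trans (limsup_le_limsup (Eventually.of_forall fun r => ?_)) hlim.le
  simp only [← ENNReal.add_div, union_inter_distrib_right]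
  exact ENNReal.div_le_div_right (measure_union_le _ _) _

lemma essBdry_union_subset (μ : Measure X) (F G : Set X) :
    essBdry μ (F ∪ G) ⊆ essBdry μ F ∪ essBdry μ G := by
  rintro x ⟨h1, h2⟩
  by_cases hF : upperDens μ F x = 0
  · refine Or.inr ⟨pos_iff_ne_zero.2 fun hG => h1.ne' (upperDens_union_eq_zero hF hG),
      h2.trans_le (upperDens_mono μ (compl_subset_compl.2 subset_union_right) x)⟩
  · exact Or.inl ⟨pos_iff_ne_zero.2 hF,
      h2.trans_le (upperDens_mono μ (compl_subset_compl.2 subset_union_left) x)⟩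

lemma perim_empty (μ : Measure X) (B : Set X) : perim μ ∅ B = 0 := by
  refine le_antisymm ?_ bot_le
  refine iInf_le_of_le univ (iInf_le_of_le isOpen_univ (iInf_le_of_le (subset_univ B) ?_))
  refine sInf_le ⟨fun _ _ => 0, fun _ x _ => ⟨0, univ, univ_mem, ?_⟩, ?_, ?_⟩
  · exact (LipschitzWith.const (0 : ℝ)).lipschitzOnWith
  · intro K _ _
    simp
  · have : lipConst (fun _ : X => (0 : ℝ)) = fun _ => 0 := by
      funext x
      simp only [lipConst, sub_self, abs_zero, zero_div, ENNReal.ofReal_zero]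
      exact limsup_const_bot
    simp [this]

lemma finPerim_empty (μ : Measure X) : FinPerim μ (∅ : Set X) :=
  ⟨MeasurableSet.empty, by simp [perim_empty]⟩

lemma perim_le_perim_univ (μ : Measure X) (E B : Set X) : perim μ E B ≤ perim μ E univ :=
  le_iInf fun Ω => le_iInf fun hΩ => le_iInf fun h =>
    iInf_le_of_le Ω (iInf_le_of_le hΩ (iInf_le _ ((subset_univ B).trans h)))

lemma PerimRepr.codimH_empty {μ : Measure X} {θ : Set X → X → ℝ≥0∞} (hθ : PerimRepr μ θ) :
    codimH μ (∅ : Set X) = 0 := by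
  obtain ⟨γ, C, -, -, h⟩ := hθ
  have := (h ∅ (finPerim_empty μ)).2 ∅ MeasurableSet.empty
  rw [perim_empty] at this
  simpa [outerLint, eq_comm] using this

lemma PerimRepr.perim_eq {μ : Measure X} {θ : Set X → X → ℝ≥0∞} (hθ : PerimRepr μ θ)
    {E : Set X} (hE : FinPerim μ E) {B : Set X} (hB : MeasurableSet B) :
    perim μ E B = outerLint (codimH μ) (B ∩ essBdry μ E) (θ E) := by
  obtain ⟨γ, C, -, -, h⟩ := hθ
  exact (h E hE).2 B hB

lemma PerimRepr.perim_eq_add_diff [BorelSpace X] {μ : Measure X} {θ : Set X → X → ℝ≥0∞}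
    (hθ : PerimRepr μ θ) {E : Set X} (hE : FinPerim μ E) {B B' : Set X}
    (hB : MeasurableSet B) (hB' : MeasurableSet B') (h : B ⊆ B') :
    perim μ E B' = perim μ E B + perim μ E (B' \ B) := by
  rw [hθ.perim_eq hE hB, hθ.perim_eq hE hB', hθ.perim_eq hE (hB'.diff hB)]
  have key := outerLint_inter_add_diff _ (isMetric_codimHOuter μ hθ.codimH_empty)
    (B' ∩ essBdry μ E) (θ E) hB
  have h1 : B' ∩ essBdry μ E ∩ B = B ∩ essBdry μ E := by
    rw [inter_right_comm, inter_eq_self_of_subset_right h]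
  have h2 : (B' ∩ essBdry μ E) \ B = B' \ B ∩ essBdry μ E := by
    ext x
    simp only [mem_inter_iff, Set.mem_sdiff]
    tauto
  rw [h1, h2] at key
  exact key

lemma Isotropic.perim_union_le {μ : Measure X} (h : Isotropic μ) {F G : Set X}
    (hF : FinPerim μ F) (hG : FinPerim μ G) (hFG : FinPerim μ (F ∪ G)) {B : Set X}
    (hB : MeasurableSet B) : perim μ (F ∪ G) B ≤ perim μ F B + perim μ G B := by
  obtain ⟨θ, hθ, hiso⟩ := h
  rw [hθ.perim_eq hF hB, hθ.perim_eq hG hB, hθ.perim_eq hFG hB]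
  have hNF := hiso _ F hFG hF subset_union_left
  have hNG := hiso _ G hFG hG subset_union_right
  set NF := {x ∈ essBdry μ F ∩ essBdry μ (F ∪ G) | θ F x ≠ θ (F ∪ G) x}
  set NG := {x ∈ essBdry μ G ∩ essBdry μ (F ∪ G) | θ G x ≠ θ (F ∪ G) x}
  let m := codimHOuter μ hθ.codimH_empty
  have hanti : Antitone fun t : ℝ => m {x ∈ B ∩ essBdry μ F | ENNReal.ofReal t < θ F x} :=
    fun a b hab => measure_mono fun x hx =>
      ⟨hx.1, (ENNReal.ofReal_le_ofReal hab).trans_lt hx.2⟩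
  change outerLint m _ _ ≤ outerLint m _ _ + outerLint m _ _
  unfold outerLint
  rw [← lintegral_add_left hanti.measurable]
  refine lintegral_mono fun t => ?_
  set SF := {x ∈ B ∩ essBdry μ F | ENNReal.ofReal t < θ F x}
  set SG := {x ∈ B ∩ essBdry μ G | ENNReal.ofReal t < θ G x}
  have hsub : {x ∈ B ∩ essBdry μ (F ∪ G) | ENNReal.ofReal t < θ (F ∪ G) x} ⊆
      (SF ∪ SG) ∪ (NF ∪ NG) := by
    rintro x ⟨⟨hxB, hx⟩, hxt⟩
    rcases essBdry_union_subset μ F G hx with hxF | hxG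
    · by_cases he : θ F x = θ (F ∪ G) x
      · exact Or.inl (Or.inl ⟨⟨hxB, hxF⟩, he ▸ hxt⟩)
      · exact Or.inr (Or.inl ⟨⟨hxF, hx⟩, he⟩)
    · by_cases he : θ G x = θ (F ∪ G) x
      · exact Or.inl (Or.inr ⟨⟨hxB, hxG⟩, he ▸ hxt⟩)
      · exact Or.inr (Or.inr ⟨⟨hxG, hx⟩, he⟩)
  have hnull : m (NF ∪ NG) = 0 := measure_union_null hNF hNG
  calc m {x ∈ B ∩ essBdry μ (F ∪ G) | ENNReal.ofReal t < θ (F ∪ G) x}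
      ≤ m (SF ∪ SG) + m (NF ∪ NG) := (measure_mono hsub).trans (measure_union_le _ _)
    _ ≤ m SF + m SG := by
      rw [hnull, add_zero]
      exact measure_union_le _ _

end Perimeter

variable {X : Type*} [MetricSpace X] [CompleteSpace X] [TopologicalSpace.SeparableSpace X]
  [MeasurableSpace X] [BorelSpace X]

/-- Indecomposability in a larger set. -/
theorem indecomposableIn_mono
    (μ : Measure X) [IsLocallyFiniteMeasure μ] (hμ : μ ≠ 0)
    (hPI : IsPI μ) (hIso : Isotropic μ)
    (E B B' : Set X) (hE : FinPerim μ E)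
    (hB : MeasurableSet B) (hB' : MeasurableSet B')
    (hEB : E ⊆ B) (hBB' : B ⊆ B')
    (h : IndecomposableIn μ E B) :
    IndecomposableIn μ E B' := by
  refine ⟨hE, ?_⟩
  rintro ⟨F, G, hF, hG, hdisj, hunion, hF0, hG0, hadd⟩
  rw [inter_eq_self_of_subset_left (hEB.trans hBB')] at hunion
  subst hunion
  refine h.2 ⟨F, G, hF, hG, hdisj, (inter_eq_self_of_subset_left hEB).symm, hF0, hG0,
    le_antisymm (hIso.perim_union_le hF hG hE hB) ?_⟩
  have hle := hIso.perim_union_le hF hG hE (hB'.diff hB)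
  obtain ⟨θ, hθ, -⟩ := hIso
  rw [hθ.perim_eq_add_diff hE hB hB' hBB', hθ.perim_eq_add_diff hF hB hB' hBB',
    hθ.perim_eq_add_diff hG hB hB' hBB', add_add_add_comm] at hadd
  have hfin : perim μ F (B' \ B) + perim μ G (B' \ B) ≠ ⊤ :=
    ENNReal.add_ne_top.2 ⟨((perim_le_perim_univ μ F _).trans_lt hF.2).ne,
      ((perim_le_perim_univ μ G _).trans_lt hG.2).ne⟩
  refine (ENNReal.add_le_add_iff_right hfin).1 ?_
  rw [← hadd]
  gcongr

end PaperBV
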